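/- Let 𝒜 be a Banach lattice algebra, let 𝔛 be a Banach lattice 𝒜-module with dual Banach lattice 𝒜-module 𝔛′, and let (e_n) be a norm-bounded sequence of positive idempotents in 𝒜 with e_n ≤ e_{n+1} and e_n e_m = e_{min(n,m)} for all n, m. Then: (a) for every x′ ∈ 𝔛′₊ the suprema sup_n e_n·x′ and sup_n x′·e_n exist in 𝔛′, and the induced linear maps E, F : 𝔛′ → 𝔛′ are bounded and satisfy (Ex′)(x) = lim_n (e_n·x′)(x) and (Fx′)(x) = lim_n (x′·e_n)(x) for all x ∈ 𝔛 and x′ ∈ 𝔛′; (b) E and F are projections and EF = FE; (c) E(𝔛′) + F(𝔛′) is norm-closed in 𝔛′. -/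

import Mathlib

/- STATEMENT 16: For a norm-bounded increasing sequence (e n) of positive idempotents
   in a Banach lattice algebra 𝒜 acting on a Banach lattice 𝒜-module 𝔛, the maps
   E, F on the dual 𝔛′ given by Ex′ = sup_n e_n·x′, Fx′ = sup_n x′·e_n are bounded
   commuting projections, computed as weak* limits, and E(𝔛′) + F(𝔛′) is norm-closed. -/

open Filter Topology

/-- The dual order on 𝔛′ = 𝔛 →L[ℝ] ℝ. -/
def dualLe {𝔛 : Type*} [NormedAddCommGroup 𝔛] [Lattice 𝔛] [HasSolidNorm 𝔛] [IsOrderedAddMonoid 𝔛] [NormedSpace ℝ 𝔛]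
    (f g : 𝔛 →L[ℝ] ℝ) : Prop := ∀ x : 𝔛, 0 ≤ x → f x ≤ g x

/-- Least upper bound with respect to the dual order. -/
def dualIsLUB {𝔛 : Type*} [NormedAddCommGroup 𝔛] [Lattice 𝔛] [HasSolidNorm 𝔛] [IsOrderedAddMonoid 𝔛] [NormedSpace ℝ 𝔛]
    (S : Set (𝔛 →L[ℝ] ℝ)) (f : 𝔛 →L[ℝ] ℝ) : Prop :=
  (∀ g ∈ S, dualLe g f) ∧ ∀ h : 𝔛 →L[ℝ] ℝ, (∀ g ∈ S, dualLe g h) → dualLe f h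

section MonotoneBounded

variable {X : Type*} [NormedAddCommGroup X] [NormedSpace ℝ X]

/-- The weak* limit of adjoints of operators with `T n ∘ T m = T (min m n)` is a projection. -/
lemma weakStar_limit_idem {T : ℕ → X →ₗ[ℝ] X} (hTT : ∀ m n x, T m (T n x) = T (min n m) x)
    {E : (X →L[ℝ] ℝ) →L[ℝ] (X →L[ℝ] ℝ)}
    (hE : ∀ f x, Tendsto (fun n => f (T n x)) atTop (𝓝 (E f x))) (f : X →L[ℝ] ℝ) :
    E (E f) = E f := by
  ext x
  refine tendsto_nhds_unique (hE (E f) x) ((hE f x).congr fun n => ?_)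
  refine tendsto_nhds_unique (tendsto_const_nhds.congr' ?_) (hE f (T n x))
  filter_upwards [eventually_ge_atTop n] with m hm
  rw [hTT, min_eq_left hm]

variable [Lattice X] [IsOrderedAddMonoid X]

/-- Along an increasing sequence whose increments are seen by `f` with size at least `ε`, flipping
signs of increments produces an element on which `f` is large, dominated by the total increment. -/
lemma exists_abs_le_sub_of_increments {z : ℕ → X} (hz : Monotone z) (f : X →L[ℝ] ℝ) {ε : ℝ}
    (hε : ∀ k, ε ≤ |f (z (k + 1)) - f (z k)|) (N : ℕ) :
    ∃ w : X, |w| ≤ z N - z 0 ∧ N * ε ≤ f w := by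
  induction N with
  | zero => exact ⟨0, by simp⟩
  | succ N ih =>
    obtain ⟨w, hw, hfw⟩ := ih
    have hd : |z (N + 1) - z N| = z (N + 1) - z N :=
      abs_of_nonneg (sub_nonneg.2 (hz N.le_succ))
    have htot : |w| + |z (N + 1) - z N| ≤ z (N + 1) - z 0 := by
      rw [hd]
      calc |w| + (z (N + 1) - z N) ≤ (z N - z 0) + (z (N + 1) - z N) := by gcongr
        _ = z (N + 1) - z 0 := by abel
    have hN := hε N
    rcases abs_cases (f (z (N + 1)) - f (z N)) with h | h
    · refine ⟨w + (z (N + 1) - z N), (abs_add_le _ _).trans htot, ?_⟩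
      simp only [map_add, map_sub]
      push_cast
      linarith
    · refine ⟨w - (z (N + 1) - z N), ?_, ?_⟩
      · rw [sub_eq_add_neg]
        refine (abs_add_le _ _).trans ?_
        rwa [abs_neg]
      · simp only [map_sub]
        push_cast
        linarith

variable [HasSolidNorm X]

/-- A norm-bounded monotone net in a normed lattice is weakly Cauchy. -/
lemma exists_tendsto_of_monotone_of_norm_le {ι : Type*} [SemilatticeSup ι] [Nonempty ι] {y : ι → X}
    (hy : Monotone y) {K : ℝ} (hK : ∀ i, ‖y i‖ ≤ K) (f : X →L[ℝ] ℝ) :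
    ∃ l, Tendsto (fun i => f (y i)) atTop (𝓝 l) := by
  refine cauchySeq_tendsto_of_complete (Metric.cauchySeq_iff'.2 fun ε hε => ?_)
  by_contra! h
  choose g hg hgε using h
  obtain ⟨i₀⟩ := ‹Nonempty ι›
  have hsucc : ∀ k, g^[k + 1] i₀ = g (g^[k] i₀) := fun k => Function.iterate_succ_apply' g k i₀
  have hz : Monotone fun k => y (g^[k] i₀) :=
    monotone_nat_of_le_succ fun k => hy (by rw [hsucc]; exact hg _)
  obtain ⟨N, hN⟩ := exists_nat_gt (‖f‖ * (K + K) / ε)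
  obtain ⟨w, hw, hfw⟩ := exists_abs_le_sub_of_increments hz f (ε := ε)
    (fun k => by simp only [hsucc]; exact hgε _) N
  have hwK : ‖w‖ ≤ K + K :=
    (norm_le_norm_of_abs_le_abs (hw.trans (le_abs_self _))).trans
      ((norm_sub_le _ _).trans (add_le_add (hK _) (hK _)))
  have hfK : f w ≤ ‖f‖ * (K + K) :=
    (le_abs_self _).trans ((f.le_opNorm w).trans (by gcongr))
  rw [div_lt_iff₀ hε] at hN
  linarith

/-- The pointwise weak* limit of the adjoints of an increasing bounded sequence of operators. -/
lemma exists_weakStar_limit (T : ℕ → X →ₗ[ℝ] X) {K : ℝ} (hK : ∀ n x, ‖T n x‖ ≤ K * ‖x‖)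
    (hT : ∀ x, 0 ≤ x → Monotone fun n => T n x) :
    ∃ E : (X →L[ℝ] ℝ) →L[ℝ] (X →L[ℝ] ℝ),
      ∀ f x, Tendsto (fun n => f (T n x)) atTop (𝓝 (E f x)) := by
  have hlim : ∀ (f : X →L[ℝ] ℝ) (x : X), ∃ l, Tendsto (fun n => f (T n x)) atTop (𝓝 l) := by
    intro f x
    obtain ⟨p, hp⟩ := exists_tendsto_of_monotone_of_norm_le (hT x⁺ (posPart_nonneg x))
      (fun n => hK n _) f
    obtain ⟨q, hq⟩ := exists_tendsto_of_monotone_of_norm_le (hT x⁻ (negPart_nonneg x))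
      (fun n => hK n _) f
    refine ⟨p - q, (hp.sub hq).congr fun n => ?_⟩
    rw [← map_sub, ← map_sub, posPart_sub_negPart]
  choose g hg using hlim
  let B : (X →L[ℝ] ℝ) →ₗ[ℝ] X →ₗ[ℝ] ℝ := LinearMap.mk₂ ℝ g
    (fun f f' x => tendsto_nhds_unique (hg _ _) ((hg f x).add (hg f' x)))
    (fun c f x => tendsto_nhds_unique (hg _ _) ((hg f x).const_mul c))
    (fun f x x' => tendsto_nhds_unique (hg _ _)
      (((hg f x).add (hg f x')).congr fun n => by simp))
    (fun c f x => tendsto_nhds_unique (hg _ _)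
      (((hg f x).const_mul c).congr fun n => by simp))
  refine ⟨B.mkContinuous₂ K fun f x => ?_, fun f x => hg f x⟩
  refine le_of_tendsto (hg f x).norm (Eventually.of_forall fun n => ?_)
  calc ‖f (T n x)‖ ≤ ‖f‖ * ‖T n x‖ := f.le_opNorm _
    _ ≤ ‖f‖ * (K * ‖x‖) := by gcongr; exact hK n x
    _ = K * ‖f‖ * ‖x‖ := by ring

/-- The limit of a convergent double sequence is the limit of its row limits. -/
lemma tendsto_of_tendsto_prod_of_tendsto {u : ℕ × ℕ → ℝ} {l : ℝ} (hu : Tendsto u atTop (𝓝 l))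
    {a : ℕ → ℝ} (ha : ∀ n, Tendsto (fun m => u (m, n)) atTop (𝓝 (a n))) :
    Tendsto a atTop (𝓝 l) := by
  refine Metric.tendsto_atTop'.2 fun ε hε => ?_
  obtain ⟨⟨M, N⟩, hMN⟩ := Metric.tendsto_atTop.1 hu (ε / 2) (half_pos hε)
  refine ⟨N, fun n hn => lt_of_le_of_lt ?_ (half_lt_self hε)⟩
  refine le_of_tendsto ((ha n).dist tendsto_const_nhds) ?_
  filter_upwards [eventually_ge_atTop M] with m hm
  exact (hMN (m, n) ⟨hm, hn.le⟩).le

/-- Weak* limits of adjoints of two commuting increasing bounded sequences of positive operators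
commute. -/
lemma weakStar_limits_comm {S T : ℕ → X →ₗ[ℝ] X} {K : ℝ}
    (hSK : ∀ n x, ‖S n x‖ ≤ K * ‖x‖) (hTK : ∀ n x, ‖T n x‖ ≤ K * ‖x‖)
    (hS : ∀ x, 0 ≤ x → Monotone fun n => S n x) (hT : ∀ x, 0 ≤ x → Monotone fun n => T n x)
    (hSpos : ∀ n x, 0 ≤ x → 0 ≤ S n x) (hTpos : ∀ n x, 0 ≤ x → 0 ≤ T n x)
    (hST : ∀ m n x, S m (T n x) = T n (S m x)) {E F : (X →L[ℝ] ℝ) →L[ℝ] (X →L[ℝ] ℝ)}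
    (hE : ∀ f x, Tendsto (fun n => f (T n x)) atTop (𝓝 (E f x)))
    (hF : ∀ f x, Tendsto (fun n => f (S n x)) atTop (𝓝 (F f x))) (f : X →L[ℝ] ℝ) :
    E (F f) = F (E f) := by
  have key : ∀ x, 0 ≤ x → E (F f) x = F (E f) x := by
    intro x hx
    have hmono : Monotone fun p : ℕ × ℕ => S p.1 (T p.2 x) := by
      rintro ⟨m, n⟩ ⟨m', n'⟩ ⟨hm, hn⟩
      refine (hS _ (hTpos n x hx) hm).trans ?_
      simp only [hST]
      exact hT _ (hSpos m' x hx) hn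
    have hbdd : ∀ p : ℕ × ℕ, ‖S p.1 (T p.2 x)‖ ≤ |K| * (|K| * ‖x‖) := fun p => by
      calc ‖S p.1 (T p.2 x)‖ ≤ K * ‖T p.2 x‖ := hSK _ _
        _ ≤ |K| * ‖T p.2 x‖ := by gcongr; exact le_abs_self K
        _ ≤ |K| * (K * ‖x‖) := by gcongr; exact hTK _ _
        _ ≤ |K| * (|K| * ‖x‖) := by gcongr; exact le_abs_self K
    obtain ⟨l, hl⟩ := exists_tendsto_of_monotone_of_norm_le hmono hbdd f
    have h₁ := tendsto_of_tendsto_prod_of_tendsto hl fun n => hF f (T n x)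
    have hl' : Tendsto (fun p : ℕ × ℕ => f (S p.2 (T p.1 x))) atTop (𝓝 l) := by
      rw [← prod_atTop_atTop_eq] at hl ⊢
      exact hl.comp (tendsto_snd.prodMk tendsto_fst)
    have h₂ := tendsto_of_tendsto_prod_of_tendsto hl' fun m => by
      simpa only [hST] using hE f (S m x)
    exact (tendsto_nhds_unique (hE (F f) x) h₁).trans (tendsto_nhds_unique (hF (E f) x) h₂).symm
  ext x
  rw [← posPart_sub_negPart x, map_sub, map_sub, key _ (posPart_nonneg x),
    key _ (negPart_nonneg x)]

/-- The weak* limit of adjoints of an increasing sequence of operators is, on positive functionals,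
the supremum in the dual order. -/
lemma dualIsLUB_weakStar_limit {T : ℕ → X →ₗ[ℝ] X} (hT : ∀ x, 0 ≤ x → Monotone fun n => T n x)
    {D : ℕ → X →L[ℝ] ℝ} {f g : X →L[ℝ] ℝ} (hD : ∀ n x, D n x = f (T n x)) (hf : dualLe 0 f)
    (hg : ∀ x, Tendsto (fun n => f (T n x)) atTop (𝓝 (g x))) :
    dualIsLUB (Set.range D) g := by
  have hfmono : Monotone f := fun a b hab => by
    have := hf (b - a) (sub_nonneg.2 hab)
    simpa using this
  refine ⟨?_, fun h hh x hx => le_of_tendsto' (hg x) fun n => ?_⟩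
  · rintro _ ⟨n, rfl⟩ x hx
    rw [hD]
    exact (hfmono.comp (hT x hx)).ge_of_tendsto (hg x) n
  · rw [← hD]
    exact hh _ ⟨n, rfl⟩ x hx

end MonotoneBounded

/-- The sum of the ranges of two commuting continuous projections is closed. -/
lemma isClosed_range_add_range_of_commuting_projections {V : Type*} [NormedAddCommGroup V]
    [NormedSpace ℝ V] {E F : V →L[ℝ] V} (hE : ∀ v, E (E v) = E v) (hF : ∀ v, F (F v) = F v)
    (hEF : ∀ v, E (F v) = F (E v)) : IsClosed {f : V | ∃ g h : V, f = E g + F h} := by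
  have hset : {f : V | ∃ g h : V, f = E g + F h} = {f | E f + F (f - E f) = f} := by
    ext f
    constructor
    · rintro ⟨g, h, rfl⟩
      simp [hE, hF, hEF]
    · intro hf
      exact ⟨f, f - E f, hf.symm⟩
  rw [hset]
  exact isClosed_eq (by fun_prop) continuous_id

theorem dual_module_projections
    {𝒜 𝔛 : Type*}
    -- 𝒜 is a Banach lattice algebra:
    [NormedRing 𝒜] [NormedAlgebra ℝ 𝒜] [CompleteSpace 𝒜] [Lattice 𝒜]
    (h𝒜add : ∀ a b c : 𝒜, a ≤ b → a + c ≤ b + c)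
    (h𝒜smul : ∀ (r : ℝ) (a : 𝒜), 0 ≤ r → 0 ≤ a → 0 ≤ r • a)
    (h𝒜mul : ∀ a b : 𝒜, 0 ≤ a → 0 ≤ b → 0 ≤ a * b)
    (h𝒜latnorm : ∀ a b : 𝒜, |a| ≤ |b| → ‖a‖ ≤ ‖b‖)
    -- 𝔛 is a Banach lattice:
    [NormedAddCommGroup 𝔛] [Lattice 𝔛] [HasSolidNorm 𝔛] [IsOrderedAddMonoid 𝔛] [NormedSpace ℝ 𝔛] [CompleteSpace 𝔛]
    -- 𝔛 is a Banach lattice 𝒜-module, with left action L and right action R: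
    (L : 𝒜 →ₗ[ℝ] 𝔛 →ₗ[ℝ] 𝔛) (R : 𝒜 →ₗ[ℝ] 𝔛 →ₗ[ℝ] 𝔛) (M : ℝ)
    (hLmul : ∀ (a b : 𝒜) (x : 𝔛), L (a * b) x = L a (L b x))
    (hRmul : ∀ (a b : 𝒜) (x : 𝔛), R (a * b) x = R b (R a x))
    (hLR : ∀ (a b : 𝒜) (x : 𝔛), L a (R b x) = R b (L a x))
    (hLpos : ∀ (a : 𝒜) (x : 𝔛), 0 ≤ a → 0 ≤ x → 0 ≤ L a x)
    (hRpos : ∀ (a : 𝒜) (x : 𝔛), 0 ≤ a → 0 ≤ x → 0 ≤ R a x)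
    (hLbd : ∀ (a : 𝒜) (x : 𝔛), ‖L a x‖ ≤ M * ‖a‖ * ‖x‖)
    (hRbd : ∀ (a : 𝒜) (x : 𝔛), ‖R a x‖ ≤ M * ‖a‖ * ‖x‖)
    -- the dual module products on 𝔛′ = 𝔛 →L[ℝ] ℝ :
    (DL DR : 𝒜 → (𝔛 →L[ℝ] ℝ) → (𝔛 →L[ℝ] ℝ))
    (hDL : ∀ (a : 𝒜) (x' : 𝔛 →L[ℝ] ℝ) (x : 𝔛), DL a x' x = x' (R a x))
    (hDR : ∀ (a : 𝒜) (x' : 𝔛 →L[ℝ] ℝ) (x : 𝔛), DR a x' x = x' (L a x))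
    -- (e n) is a norm-bounded increasing sequence of positive idempotents:
    (e : ℕ → 𝒜) (C : ℝ)
    (hebd : ∀ n, ‖e n‖ ≤ C)
    (hepos : ∀ n, 0 ≤ e n)
    (hemono : ∀ n, e n ≤ e (n + 1))
    (heprod : ∀ n m, e n * e m = e (min n m)) :
    ∃ E F : (𝔛 →L[ℝ] ℝ) →L[ℝ] (𝔛 →L[ℝ] ℝ),
      -- (a) E and F are determined by the suprema, which exist:
      (∀ x' : 𝔛 →L[ℝ] ℝ, dualLe 0 x' →
        dualIsLUB (Set.range fun n => DL (e n) x') (E x') ∧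
        dualIsLUB (Set.range fun n => DR (e n) x') (F x')) ∧
      -- (a) weak* limit formulas:
      (∀ (x' : 𝔛 →L[ℝ] ℝ) (x : 𝔛),
        Tendsto (fun n => DL (e n) x' x) atTop (𝓝 (E x' x)) ∧
        Tendsto (fun n => DR (e n) x' x) atTop (𝓝 (F x' x))) ∧
      -- (b) E and F are commuting projections:
      (∀ x' : 𝔛 →L[ℝ] ℝ, E (E x') = E x' ∧ F (F x') = F x' ∧ E (F x') = F (E x')) ∧
      -- (c) E(𝔛′) + F(𝔛′) is norm-closed:
      IsClosed {f : 𝔛 →L[ℝ] ℝ | ∃ g h : 𝔛 →L[ℝ] ℝ, f = E g + F h} := by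
  have hemono' : Monotone e := monotone_nat_of_le_succ hemono
  have hsub : ∀ {m n}, m ≤ n → 0 ≤ e n - e m := fun {m n} hmn => by
    simpa [sub_eq_add_neg] using h𝒜add _ _ (-e m) (hemono' hmn)
  have hbd : ∀ {A : 𝒜 →ₗ[ℝ] 𝔛 →ₗ[ℝ] 𝔛}, (∀ a x, ‖A a x‖ ≤ M * ‖a‖ * ‖x‖) →
      ∀ n x, ‖A (e n) x‖ ≤ |M| * C * ‖x‖ := fun {A} hA n x => by
    refine (hA _ _).trans ?_
    gcongr
    · exact le_abs_self M
    · exact hebd n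
  have hmono : ∀ {A : 𝒜 →ₗ[ℝ] 𝔛 →ₗ[ℝ] 𝔛}, (∀ a x, 0 ≤ a → 0 ≤ x → 0 ≤ A a x) →
      ∀ x, 0 ≤ x → Monotone fun n => A (e n) x := fun {A} hA x hx m n hmn => by
    simpa using hA _ x (hsub hmn) hx
  obtain ⟨E, hE⟩ := exists_weakStar_limit (fun n => R (e n)) (hbd hRbd) (hmono hRpos)
  obtain ⟨F, hF⟩ := exists_weakStar_limit (fun n => L (e n)) (hbd hLbd) (hmono hLpos)
  have hEE : ∀ f, E (E f) = E f := weakStar_limit_idem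
    (fun m n x => by rw [← hRmul, heprod]) hE
  have hFF : ∀ f, F (F f) = F f := weakStar_limit_idem
    (fun m n x => by rw [← hLmul, heprod, min_comm]) hF
  have hEF : ∀ f, E (F f) = F (E f) := weakStar_limits_comm (hbd hLbd) (hbd hRbd)
    (hmono hLpos) (hmono hRpos) (fun n x => hLpos _ x (hepos n)) (fun n x => hRpos _ x (hepos n))
    (fun m n x => hLR _ _ x) hE hF
  refine ⟨E, F, fun x' hx' => ⟨?_, ?_⟩, fun x' x => ⟨?_, ?_⟩,
    fun x' => ⟨hEE x', hFF x', hEF x'⟩,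
    isClosed_range_add_range_of_commuting_projections hEE hFF hEF⟩
  · exact dualIsLUB_weakStar_limit (hmono hRpos) (fun n x => hDL _ _ x) hx' (hE x')
  · exact dualIsLUB_weakStar_limit (hmono hLpos) (fun n x => hDR _ _ x) hx' (hF x')
  · simpa only [hDL] using hE x' x
  · simpa only [hDR] using hF x' x
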